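/- Let α = √((1 − 1/√3)/2) and β = e^{−i5π/4}·√((1 + 1/√3)/2). For any a, b ∈ ℂ define the four intensities I_1(a,b) = |α·a + conj(β)·b|², I_2(a,b) = |conj(β)·a + α·b|², I_3(a,b) = |α·a − conj(β)·b|², I_4(a,b) = |−conj(β)·a + α·b|². If a, b, a′, b′ ∈ ℂ with a ≠ 0 satisfy I_s(a′,b′) = I_s(a,b) for s = 1, 2, 3, 4, then there exists c ∈ ℂ with |c| = 1 such that a′ = c·a and b′ = c·b. -/

import Mathlib

/-- The constant `α = √((1 − 1/√3)/2)`. -/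
noncomputable def alphaPR : ℝ := Real.sqrt ((1 - 1 / Real.sqrt 3) / 2)

/-- The constant `β = e^{−i5π/4} · √((1 + 1/√3)/2)`. -/
noncomputable def betaPR : ℂ :=
  Complex.exp (-(Complex.I * (5 * Real.pi / 4))) *
    (Real.sqrt ((1 + 1 / Real.sqrt 3) / 2) : ℝ)

/-- The four intensities `I_1, …, I_4` associated with a pair `(a, b) ∈ ℂ²`. -/
noncomputable def intensity (s : Fin 4) (a b : ℂ) : ℝ :=
  norm
    (![(alphaPR : ℂ) * a + (starRingEnd ℂ) betaPR * b,
       (starRingEnd ℂ) betaPR * a + (alphaPR : ℂ) * b,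
       (alphaPR : ℂ) * a - (starRingEnd ℂ) betaPR * b,
       -(starRingEnd ℂ) betaPR * a + (alphaPR : ℂ) * b] s) ^ 2

open Complex in
/-- Equal moduli and equal value of `x * conj y` determine a pair up to a common phase. -/
theorem exists_phase_of_mul_conj_eq {a b a' b' : ℂ} (ha : a ≠ 0) (hn : normSq a' = normSq a)
    (hz : a' * (starRingEnd ℂ) b' = a * (starRingEnd ℂ) b) :
    ∃ c : ℂ, ‖c‖ = 1 ∧ a' = c * a ∧ b' = c * b := by
  have ha' : a' ≠ 0 := by
    rwa [← normSq_pos, hn, normSq_pos]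
  have hnorm : ‖a'‖ = ‖a‖ := by
    simp only [normSq_eq_norm_sq] at hn
    exact (sq_eq_sq₀ (norm_nonneg _) (norm_nonneg _)).1 hn
  refine ⟨a' / a, ?_, (div_mul_cancel₀ a' ha).symm, ?_⟩
  · rw [norm_div, hnorm, div_self (norm_ne_zero_iff.2 ha)]
  · have hz' : (starRingEnd ℂ) a' * b' = (starRingEnd ℂ) a * b := by
      simpa using congrArg (starRingEnd ℂ) hz
    have hn' : a' * (starRingEnd ℂ) a' = a * (starRingEnd ℂ) a := by
      rw [mul_conj, mul_conj, hn]
    have hc : (starRingEnd ℂ) a' ≠ 0 := (map_ne_zero _).2 ha'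
    rw [div_mul_eq_mul_div, eq_div_iff ha]
    apply mul_left_cancel₀ hc
    linear_combination a * hz' - b * hn'

open Complex in
/-- Phase retrieval for the pair of vectors `(α, β)`, `(β, α)` and their sign changes. -/
theorem exists_phase_of_intensities_eq {α : ℝ} {β a b a' b' : ℂ} (ha : a ≠ 0)
    (hα : α ≠ 0) (hre : β.re ≠ 0) (him : β.im ≠ 0) (hαβ : α ^ 2 ≠ normSq β)
    (h₁ : normSq (α * a' + (starRingEnd ℂ) β * b') = normSq (α * a + (starRingEnd ℂ) β * b))
    (h₂ : normSq ((starRingEnd ℂ) β * a' + α * b') = normSq ((starRingEnd ℂ) β * a + α * b))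
    (h₃ : normSq (α * a' - (starRingEnd ℂ) β * b') = normSq (α * a - (starRingEnd ℂ) β * b))
    (h₄ : normSq (-(starRingEnd ℂ) β * a' + α * b') =
      normSq (-(starRingEnd ℂ) β * a + α * b)) :
    ∃ c : ℂ, ‖c‖ = 1 ∧ a' = c * a ∧ b' = c * b := by
  have hpos : α ^ 2 + normSq β ≠ 0 := by
    have := normSq_nonneg β
    positivity
  simp only [normSq_apply, add_re, add_im, sub_re, sub_im, mul_re, mul_im, neg_re, neg_im,
    conj_re, conj_im, ofReal_re, ofReal_im] at h₁ h₂ h₃ h₄ hαβ hpos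
  refine exists_phase_of_mul_conj_eq ha ?_ (Complex.ext ?_ ?_)
  · apply mul_left_cancel₀ (mul_ne_zero (sub_ne_zero.2 hαβ) hpos)
    simp only [normSq_apply]
    linear_combination α ^ 2 * (h₁ + h₃) / 2 - (β.re * β.re + β.im * β.im) * (h₂ + h₄) / 2
  · apply mul_left_cancel₀ (mul_ne_zero hα hre)
    simp only [mul_re, conj_re, conj_im]
    linear_combination (h₁ - h₃ + h₂ - h₄) / 8
  · apply mul_left_cancel₀ (mul_ne_zero hα him)
    simp only [mul_im, conj_re, conj_im]
    linear_combination (h₂ - h₄ - h₁ + h₃) / 8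

theorem one_div_sqrt_three_lt_one : 1 / √(3 : ℝ) < 1 := by
  rw [div_lt_one (by positivity), Real.lt_sqrt zero_le_one]
  norm_num

theorem alphaPR_sq : alphaPR ^ 2 = (1 - 1 / √3) / 2 :=
  Real.sq_sqrt (by linarith [one_div_sqrt_three_lt_one])

theorem alphaPR_ne_zero : alphaPR ≠ 0 :=
  (Real.sqrt_pos.2 (by linarith [one_div_sqrt_three_lt_one])).ne'

theorem betaPR_eq : betaPR =
    ⟨-(√2 / 2 * √((1 + 1 / √3) / 2)), √2 / 2 * √((1 + 1 / √3) / 2)⟩ := by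
  have harg : -(Complex.I * (5 * Real.pi / 4)) =
      ((-(Real.pi / 4 + Real.pi) : ℝ) : ℂ) * Complex.I := by
    push_cast
    ring
  rw [betaPR, harg]
  apply Complex.ext
  · rw [Complex.re_mul_ofReal, Complex.exp_ofReal_mul_I_re, Real.cos_neg, Real.cos_add_pi,
      Real.cos_pi_div_four, neg_mul]
  · rw [Complex.im_mul_ofReal, Complex.exp_ofReal_mul_I_im, Real.sin_neg, Real.sin_add_pi,
      Real.sin_pi_div_four, neg_neg]

theorem normSq_betaPR : Complex.normSq betaPR = (1 + 1 / √3) / 2 := by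
  have h₂ : √(2 : ℝ) ^ 2 = 2 := Real.sq_sqrt zero_le_two
  have hr : √((1 + 1 / √(3 : ℝ)) / 2) ^ 2 = (1 + 1 / √3) / 2 := Real.sq_sqrt (by positivity)
  rw [betaPR_eq, Complex.normSq_mk]
  linear_combination √((1 + 1 / √(3 : ℝ)) / 2) ^ 2 / 2 * h₂ + hr

/-- If `a ≠ 0` and `(a', b')` produces the same four intensities as `(a, b)`, then
`(a', b') = c·(a, b)` for some unimodular `c ∈ ℂ`. -/
theorem intensities_determine_up_to_phase
    (a b a' b' : ℂ) (ha : a ≠ 0)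
    (h : ∀ s : Fin 4, intensity s a' b' = intensity s a b) :
    ∃ c : ℂ, norm c = 1 ∧ a' = c * a ∧ b' = c * b := by
  simp only [intensity, ← Complex.normSq_eq_norm_sq] at h
  have hβ : 0 < √2 / 2 * √((1 + 1 / √(3 : ℝ)) / 2) := by positivity
  refine exists_phase_of_intensities_eq ha alphaPR_ne_zero ?_ ?_ ?_ (h 0) (h 1) (h 2) (h 3)
  · rw [betaPR_eq]
    exact neg_ne_zero.2 hβ.ne'
  · rw [betaPR_eq]
    exact hβ.ne'
  · rw [alphaPR_sq, normSq_betaPR]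
    have : 0 < 1 / √(3 : ℝ) := by positivity
    linarith
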